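/- Combes–Thomas decay (Lemma 4.2(i)): let d ≥ 1, λ > 0, E ∈ ℝ, Λ ⊂ ℤ^d a finite cube, i₁, i₂ ∈ Λ nearest-neighbour sites, and B = (λ − i(E+Δ))|_{Λ∖{i₁,i₂}}. For η > 0 set μ_λ = λη/(λ + 4d e^η). Then for all sites i, j ∈ Λ∖{i₁,i₂} the matrix entries of the inverse satisfy |(B^{−1})_{ij}| ≤ (2/λ) e^{−μ_λ |i−j|}, where |i−j| is the ℓ¹ distance on ℤ^d. -/

import Mathlib

open MeasureTheory Matrix

noncomputable section

/-- ℓ¹ distance on ℤ^d. -/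
def dist1 {d : ℕ} (x y : Fin d → ℤ) : ℤ := ∑ i, |x i - y i|

/-- The cube [-L, L]^d in ℤ^d, centered at the origin. -/
def cube (d L : ℕ) : Finset (Fin d → ℤ) :=
  Finset.Icc (fun _ => -(L : ℤ)) (fun _ => (L : ℤ))

/-- Entries of the discrete Laplacian associated to a finite volume Λ. -/
def lapE {d : ℕ} (Λ : Finset (Fin d → ℤ)) (j k : Fin d → ℤ) : ℂ :=
  (if dist1 j k = 1 then 1 else 0) -
    (if j = k then ((Λ.filter (fun k' => dist1 j k' = 1)).card : ℂ) else 0)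

/-- The matrix `B = (λ - i(E+Δ))|_{Λ∖{i₁,i₂}}`. -/
def Bmat {d : ℕ} (Λ : Finset (Fin d → ℤ)) (i₁ i₂ : Fin d → ℤ) (E lam : ℝ) :
    Matrix ((Λ.erase i₁).erase i₂) ((Λ.erase i₁).erase i₂) ℂ := fun j k =>
  (lam : ℂ) * (if j = k then 1 else 0) -
    Complex.I * ((if j = k then (E : ℂ) else 0) + lapE Λ (j : Fin d → ℤ) (k : Fin d → ℤ))

/-- A coercive matrix is invertible. -/
lemma isUnit_of_coercive {n : Type*} [Fintype n] [DecidableEq n] {M : Matrix n n ℂ} {c : ℝ}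
    (hc : 0 < c) (hM : ∀ w : n → ℂ, c * ∑ k, ‖w k‖ ^ 2 ≤ (star w ⬝ᵥ M *ᵥ w).re) :
    IsUnit M := by
  rw [← Matrix.mulVec_injective_iff_isUnit]
  refine (injective_iff_map_eq_zero M.mulVecLin).2 fun w hw => ?_
  have hw' : M *ᵥ w = 0 := hw
  have h := hM w
  rw [hw', dotProduct_zero, Complex.zero_re] at h
  have hS : ∑ k, ‖w k‖ ^ 2 = 0 :=
    le_antisymm (nonpos_of_mul_nonpos_right h hc) (Finset.sum_nonneg fun k _ => by positivity)
  rw [Finset.sum_eq_zero_iff_of_nonneg (fun k _ => by positivity)] at hS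
  funext k
  simpa using hS k (Finset.mem_univ k)

/-- The entries of the inverse of a matrix with coercivity constant `c` are at most `c⁻¹`. -/
lemma norm_inv_apply_le_of_coercive {n : Type*} [Fintype n] [DecidableEq n] {M : Matrix n n ℂ}
    {c : ℝ} (hc : 0 < c) (hM : ∀ w : n → ℂ, c * ∑ k, ‖w k‖ ^ 2 ≤ (star w ⬝ᵥ M *ᵥ w).re)
    (i j : n) : ‖M⁻¹ i j‖ ≤ c⁻¹ := by
  have hdet : IsUnit M.det := (Matrix.isUnit_iff_isUnit_det M).1 (isUnit_of_coercive hc hM)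
  set w : n → ℂ := M⁻¹ *ᵥ Pi.single j 1 with hw
  have hMw : M *ᵥ w = Pi.single j 1 := by
    rw [hw, Matrix.mulVec_mulVec, Matrix.mul_nonsing_inv _ hdet, Matrix.one_mulVec]
  have hwi : ∀ k, w k = M⁻¹ k j := fun k => by simp [hw]
  have h := hM w
  rw [hMw, dotProduct_single, mul_one] at h
  have hre : (star w j).re ≤ ‖w j‖ := by
    simpa using Complex.re_le_norm (star w j)
  have hle : ∀ k, ‖w k‖ ^ 2 ≤ ∑ l, ‖w l‖ ^ 2 := fun k =>
    Finset.single_le_sum (f := fun l => ‖w l‖ ^ 2) (fun l _ => by positivity) (Finset.mem_univ k)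
  have hj : c * ‖w j‖ ≤ 1 := by
    by_contra! hcon
    have h1 : c * ‖w j‖ ^ 2 ≤ ‖w j‖ :=
      (mul_le_mul_of_nonneg_left (hle j) hc.le).trans (h.trans hre)
    have h2 : 0 < ‖w j‖ := by
      by_contra! h0
      nlinarith
    nlinarith
  have hi : (c * ‖w i‖) ^ 2 ≤ 1 := by
    have h1 : c * ‖w i‖ ^ 2 ≤ ‖w j‖ :=
      (mul_le_mul_of_nonneg_left (hle i) hc.le).trans (h.trans hre)
    nlinarith
  rw [← hwi, ← one_div, le_div_iff₀ hc, mul_comm]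
  exact (sq_le_one_iff₀ (by positivity)).1 hi

/-- Schur test for the quadratic form of a matrix supported on a symmetric relation of
bounded degree. -/
lemma norm_dotProduct_mulVec_le_of_degree_le {n : Type*} [Fintype n] {R : Matrix n n ℂ}
    {r : n → n → Prop} [DecidableRel r] (hr : ∀ k l, r k l → r l k) {N : ℕ}
    (hN : ∀ k, (Finset.univ.filter (r k)).card ≤ N) {δ : ℝ} (hδ : 0 ≤ δ)
    (hR : ∀ k l, ‖R k l‖ ≤ if r k l then δ else 0) (w : n → ℂ) :
    ‖star w ⬝ᵥ R *ᵥ w‖ ≤ δ * N * ∑ k, ‖w k‖ ^ 2 := by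
  have hrow : ∑ k, ∑ l, (if r k l then δ else 0) * ‖w k‖ ^ 2 ≤ δ * N * ∑ k, ‖w k‖ ^ 2 := by
    rw [Finset.mul_sum]
    refine Finset.sum_le_sum fun k _ => ?_
    rw [← Finset.sum_mul, ← Finset.sum_filter, Finset.sum_const, nsmul_eq_mul, mul_comm δ]
    have := hN k
    gcongr
  have hcol : ∑ k, ∑ l, (if r k l then δ else 0) * ‖w l‖ ^ 2 =
      ∑ k, ∑ l, (if r k l then δ else 0) * ‖w k‖ ^ 2 := by
    rw [Finset.sum_comm]
    refine Finset.sum_congr rfl fun k _ => Finset.sum_congr rfl fun l _ => ?_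
    rw [if_congr (Iff.intro (hr l k) (hr k l)) rfl rfl]
  calc ‖star w ⬝ᵥ R *ᵥ w‖
      ≤ ∑ k, ∑ l, ‖w k‖ * (‖R k l‖ * ‖w l‖) := by
        simp only [dotProduct, mulVec, Finset.mul_sum]
        refine (norm_sum_le _ _).trans (Finset.sum_le_sum fun k _ => ?_)
        refine (norm_sum_le _ _).trans (Finset.sum_le_sum fun l _ => ?_)
        simp
    _ ≤ ∑ k, ∑ l, ((if r k l then δ else 0) * ‖w k‖ ^ 2 / 2 +
          (if r k l then δ else 0) * ‖w l‖ ^ 2 / 2) := by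
        refine Finset.sum_le_sum fun k _ => Finset.sum_le_sum fun l _ => ?_
        have h0 : 0 ≤ if r k l then δ else 0 := by split_ifs <;> simp [hδ]
        calc ‖w k‖ * (‖R k l‖ * ‖w l‖) = ‖R k l‖ * (‖w k‖ * ‖w l‖) := by ring
          _ ≤ (if r k l then δ else 0) * (‖w k‖ * ‖w l‖) := by
            gcongr
            exact hR k l
          _ ≤ _ := by nlinarith [mul_nonneg h0 (sq_nonneg (‖w k‖ - ‖w l‖))]
    _ ≤ δ * N * ∑ k, ‖w k‖ ^ 2 := by
        simp only [Finset.sum_add_distrib, ← Finset.sum_div]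
        linarith

lemma dist1_comm {d : ℕ} (x y : Fin d → ℤ) : dist1 x y = dist1 y x :=
  Finset.sum_congr rfl fun _ _ => abs_sub_comm _ _

lemma dist1_self {d : ℕ} (x : Fin d → ℤ) : dist1 x x = 0 := by
  simp [dist1]

lemma dist1_triangle {d : ℕ} (x y z : Fin d → ℤ) : dist1 x z ≤ dist1 x y + dist1 y z := by
  rw [dist1, dist1, dist1, ← Finset.sum_add_distrib]
  exact Finset.sum_le_sum fun _ _ => abs_sub_le _ _ _

lemma exists_eq_update_of_dist1_eq_one {d : ℕ} {x y : Fin d → ℤ} (h : dist1 x y = 1) :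
    ∃ a, y = Function.update x a (x a + 1) ∨ y = Function.update x a (x a - 1) := by
  obtain ⟨a, ha⟩ : ∃ a, x a ≠ y a := by
    by_contra! hcon
    simp [dist1, hcon] at h
  have hsplit := Finset.add_sum_erase Finset.univ (fun i => |x i - y i|) (Finset.mem_univ a)
  have hpos : 0 < |x a - y a| := abs_pos.2 (sub_ne_zero.2 ha)
  have hnn : ∀ i ∈ Finset.univ.erase a, 0 ≤ |x i - y i| := fun i _ => abs_nonneg _
  have hrest := Finset.sum_nonneg hnn
  rw [dist1] at h
  have hzero : ∑ i ∈ Finset.univ.erase a, |x i - y i| = 0 := by omega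
  have hone : |x a - y a| = 1 := by omega
  rw [Finset.sum_eq_zero_iff_of_nonneg hnn] at hzero
  have hoff : ∀ b, b ≠ a → y b = x b := fun b hb =>
    (sub_eq_zero.1 (abs_eq_zero.1 (hzero b (by simp [hb])))).symm
  refine ⟨a, ?_⟩
  rcases (abs_eq zero_le_one).1 hone with h1 | h1
  · right
    rw [Function.eq_update_iff]
    exact ⟨by omega, hoff⟩
  · left
    rw [Function.eq_update_iff]
    exact ⟨by omega, hoff⟩

/-- A site of `ℤ^d` has at most `2d` nearest neighbours in any finite set. -/
lemma card_filter_dist1_eq_one_le {d : ℕ} (Λ : Finset (Fin d → ℤ)) (x : Fin d → ℤ) :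
    (Finset.univ.filter fun l : Λ => dist1 x l = 1).card ≤ 2 * d := by
  let f : Fin d × Bool → Fin d → ℤ := fun p =>
    Function.update x p.1 (if p.2 then x p.1 + 1 else x p.1 - 1)
  calc (Finset.univ.filter fun l : Λ => dist1 x l = 1).card
      ≤ (Finset.univ.image f).card := by
        refine Finset.card_le_card_of_injOn Subtype.val (fun l hl => ?_)
          Subtype.val_injective.injOn
        simp only [Finset.coe_filter, Finset.mem_univ, true_and, Set.mem_ofPred_eq] at hl
        simp only [Finset.coe_image, Finset.coe_univ, Set.image_univ, Set.mem_range]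
        obtain ⟨a, ha | ha⟩ := exists_eq_update_of_dist1_eq_one hl
        · exact ⟨(a, true), by simp [f, ha]⟩
        · exact ⟨(a, false), by simp [f, ha]⟩
    _ ≤ (Finset.univ : Finset (Fin d × Bool)).card := Finset.card_image_le
    _ = 2 * d := by simp [mul_comm]

lemma re_dotProduct_Bmat_mulVec {d : ℕ} (Λ : Finset (Fin d → ℤ)) (i₁ i₂ : Fin d → ℤ)
    (E lam : ℝ) (w : ((Λ.erase i₁).erase i₂) → ℂ) :
    (star w ⬝ᵥ Bmat Λ i₁ i₂ E lam *ᵥ w).re = lam * ∑ k, ‖w k‖ ^ 2 := by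
  let H : Matrix ((Λ.erase i₁).erase i₂) ((Λ.erase i₁).erase i₂) ℂ :=
    Matrix.of fun j k =>
      (if j = k then (E : ℂ) else 0) + lapE Λ (j : Fin d → ℤ) (k : Fin d → ℤ)
  have hH : H.IsHermitian := by
    ext j k
    by_cases hjk : j = k
    · subst hjk
      simp [H, lapE, Matrix.conjTranspose_apply, dist1_self]
    · have hkj : k ≠ j := fun h => hjk h.symm
      simp [H, lapE, Matrix.conjTranspose_apply, hjk, hkj,
        dist1_comm (k : Fin d → ℤ) j]
  have hB : Bmat Λ i₁ i₂ E lam = (lam : ℂ) • 1 - Complex.I • H := by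
    ext j k
    rw [Matrix.sub_apply, Matrix.smul_apply, Matrix.smul_apply, Matrix.one_apply]
    rfl
  have him : (star w ⬝ᵥ H *ᵥ w).im = 0 := hH.im_star_dotProduct_mulVec_self w
  have hnorm : star w ⬝ᵥ w = ((∑ k, ‖w k‖ ^ 2 : ℝ) : ℂ) := by
    simp [dotProduct, Complex.conj_mul']
  rw [hB, Matrix.sub_mulVec, Matrix.smul_mulVec, Matrix.smul_mulVec, Matrix.one_mulVec,
    dotProduct_sub, dotProduct_smul, dotProduct_smul, hnorm]
  simp only [smul_eq_mul, Complex.sub_re, Complex.re_ofReal_mul, Complex.ofReal_re,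
    Complex.I_mul_re, him]
  ring

/-- The exponential rate in the Combes–Thomas estimate is small enough for the conjugation error
to be absorbed. -/
lemma combes_thomas_rate_bound (d : ℕ) {lam η : ℝ} (hlam : 0 < lam) :
    (Real.exp (lam * η / (lam + 4 * d * Real.exp η)) - 1) * (2 * d) ≤ lam / 2 := by
  set D := lam + 4 * d * Real.exp η with hD
  have hpos : 0 ≤ 4 * d * Real.exp η := by positivity
  have hDpos : 0 < D := by linarith
  have hconv := convexOn_exp.2 (Set.mem_univ η) (Set.mem_univ 0)
    (div_nonneg hlam.le hDpos.le) (div_nonneg hpos hDpos.le)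
    (by rw [← add_div, ← hD, div_self hDpos.ne'])
  simp only [smul_eq_mul, mul_zero, add_zero, Real.exp_zero, mul_one] at hconv
  rw [div_mul_eq_mul_div lam D η, div_mul_eq_mul_div lam D (Real.exp η), ← add_div, le_div_iff₀ hDpos] at hconv
  have hmul : (Real.exp (lam * η / D) - 1) * D ≤ lam * Real.exp η := by
    nlinarith [hconv, hD]
  have h4 : ((Real.exp (lam * η / D) - 1) * (2 * d)) * D ≤ lam / 2 * D := by
    nlinarith [mul_le_mul_of_nonneg_left hmul (by positivity : (0 : ℝ) ≤ 2 * d)]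
  exact le_of_mul_le_mul_right h4 hDpos

lemma abs_exp_sub_one_le {x m : ℝ} (h : |x| ≤ m) : |Real.exp x - 1| ≤ Real.exp m - 1 := by
  obtain ⟨h1, h2⟩ := abs_le.1 h
  rw [abs_le]
  constructor
  · have h3 := Real.exp_le_exp.2 h1
    have h4 : 1 ≤ Real.exp m := Real.one_le_exp ((abs_nonneg x).trans h)
    have h5 : Real.exp (-m) * Real.exp m = 1 := by rw [← Real.exp_add]; simp
    nlinarith [Real.exp_pos (-m), sq_nonneg (Real.exp m - 1)]
  · have := Real.exp_le_exp.2 h2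
    linarith

/-- Conjugating `B` by the weight `e^{mρ}` with `ρ` 1-Lipschitz keeps it coercive. -/
lemma coercive_conj_Bmat {d : ℕ} (Λ : Finset (Fin d → ℤ)) (i₁ i₂ : Fin d → ℤ)
    (E : ℝ) {lam m : ℝ} (hm : 0 ≤ m) (hrate : (Real.exp m - 1) * (2 * d) ≤ lam / 2)
    (ρ : ((Λ.erase i₁).erase i₂) → ℝ)
    (hρ : ∀ k l : ((Λ.erase i₁).erase i₂), dist1 (k : Fin d → ℤ) l = 1 → |ρ k - ρ l| ≤ 1)
    (w : ((Λ.erase i₁).erase i₂) → ℂ) :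
    lam / 2 * ∑ k, ‖w k‖ ^ 2 ≤
      (star w ⬝ᵥ (diagonal (fun k => (Real.exp (m * ρ k) : ℂ)) * Bmat Λ i₁ i₂ E lam *
        diagonal (fun k => (Real.exp (-(m * ρ k)) : ℂ))) *ᵥ w).re := by
  set B := Bmat Λ i₁ i₂ E lam with hB
  set A := diagonal (fun k => (Real.exp (m * ρ k) : ℂ)) * B *
    diagonal (fun k => (Real.exp (-(m * ρ k)) : ℂ)) with hA
  have hentry : ∀ k l, (A - B) k l = B k l * ((Real.exp (m * (ρ k - ρ l)) - 1 : ℝ) : ℂ) := by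
    intro k l
    rw [hA, Matrix.sub_apply, Matrix.mul_diagonal, Matrix.diagonal_mul,
      show m * (ρ k - ρ l) = m * ρ k + -(m * ρ l) by ring, Real.exp_add]
    push_cast
    ring
  have hδ : 0 ≤ Real.exp m - 1 := sub_nonneg.2 (Real.one_le_exp hm)
  have hR : ∀ k l, ‖(A - B) k l‖ ≤
      if dist1 (k : Fin d → ℤ) l = 1 then Real.exp m - 1 else 0 := by
    intro k l
    rw [hentry]
    by_cases hkl : k = l
    · subst hkl
      simp [dist1_self]
    · have hkl' : (k : Fin d → ℤ) ≠ l := fun h => hkl (Subtype.ext h)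
      split_ifs with hd
      · have hBkl : ‖B k l‖ = 1 := by simp [hB, Bmat, lapE, hkl, hkl', hd]
        rw [norm_mul, hBkl, one_mul, Complex.norm_real]
        refine abs_exp_sub_one_le ?_
        rw [abs_mul, abs_of_nonneg hm]
        exact mul_le_of_le_one_right hm (hρ k l hd)
      · simp [hB, Bmat, lapE, hkl, hkl', hd]
  have hschur := norm_dotProduct_mulVec_le_of_degree_le
    (r := fun k l : ((Λ.erase i₁).erase i₂) => dist1 (k : Fin d → ℤ) l = 1)
    (fun k l h => by rwa [dist1_comm]) (N := 2 * d)
    (fun k => card_filter_dist1_eq_one_le _ _) hδ hR w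
  have hre := (abs_le.1 ((Complex.abs_re_le_norm _).trans hschur)).1
  have hsum : (star w ⬝ᵥ A *ᵥ w).re =
      (star w ⬝ᵥ B *ᵥ w).re + (star w ⬝ᵥ (A - B) *ᵥ w).re := by
    rw [Matrix.sub_mulVec, dotProduct_sub, Complex.sub_re]
    ring
  rw [hsum, hB, re_dotProduct_Bmat_mulVec, ← hB]
  have hS : 0 ≤ ∑ k, ‖w k‖ ^ 2 := Finset.sum_nonneg fun k _ => by positivity
  push_cast at hre
  nlinarith [mul_le_mul_of_nonneg_right hrate hS]

/-- Lemma 4.2(i), Combes–Thomas decay. For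
`B = (λ - i(E+Δ))|_{Λ∖{i₁,i₂}}` and `μ_λ = λη/(λ + 4d e^η)` (any `η > 0`), the entries
of `B⁻¹` decay exponentially: `|(B⁻¹)_{ij}| ≤ (2/λ) e^{-μ_λ|i-j|₁}`. -/
theorem combes_thomas_decay (d L : ℕ) (hd : 1 ≤ d) (E lam : ℝ) (hlam : 0 < lam)
    (i₁ i₂ : Fin d → ℤ) (hnn : dist1 i₁ i₂ = 1)
    (hi₁ : i₁ ∈ cube d L) (hi₂ : i₂ ∈ cube d L)
    (η : ℝ) (hη : 0 < η) :
    ∀ i j : ↥(((cube d L).erase i₁).erase i₂),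
      ‖(Bmat (cube d L) i₁ i₂ E lam)⁻¹ i j‖ ≤
        (2 / lam) * Real.exp (-(lam * η / (lam + 4 * d * Real.exp η)) *
          ((dist1 (i : Fin d → ℤ) (j : Fin d → ℤ) : ℤ) : ℝ)) := by
  intro i j
  set B := Bmat (cube d L) i₁ i₂ E lam
  set m := lam * η / (lam + 4 * d * Real.exp η) with hm_def
  have hm : 0 ≤ m := by positivity
  let ρ : ↥(((cube d L).erase i₁).erase i₂) → ℝ := fun k =>
    ((dist1 (k : Fin d → ℤ) (j : Fin d → ℤ) : ℤ) : ℝ)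
  have hρ : ∀ k l : ↥(((cube d L).erase i₁).erase i₂),
      dist1 (k : Fin d → ℤ) l = 1 → |ρ k - ρ l| ≤ 1 := by
    intro k l hkl
    have h1 := dist1_triangle (k : Fin d → ℤ) l j
    have h2 := dist1_triangle (l : Fin d → ℤ) k j
    rw [dist1_comm (l : Fin d → ℤ) k] at h2
    have h3 : |dist1 (k : Fin d → ℤ) j - dist1 (l : Fin d → ℤ) j| ≤ 1 := by
      rw [abs_le]
      omega
    simp only [ρ]
    exact_mod_cast h3
  have key := norm_inv_apply_le_of_coercive (half_pos hlam)
    (coercive_conj_Bmat (cube d L) i₁ i₂ E hm (combes_thomas_rate_bound d hlam) ρ hρ) i j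
  have hinv : ∀ g : ↥(((cube d L).erase i₁).erase i₂) → ℝ,
      (diagonal (fun k => (Real.exp (g k) : ℂ)))⁻¹ =
        diagonal (fun k => (Real.exp (-g k) : ℂ)) := by
    intro g
    refine Matrix.inv_eq_right_inv ?_
    rw [Matrix.diagonal_mul_diagonal, ← Matrix.diagonal_one]
    congr 1
    funext k
    rw [← Complex.ofReal_mul, ← Real.exp_add]
    simp
  rw [Matrix.mul_inv_rev, Matrix.mul_inv_rev, hinv, hinv, ← mul_assoc, Matrix.mul_diagonal,
    Matrix.diagonal_mul, show ρ j = 0 by simp [ρ, dist1_self], neg_neg, mul_zero, neg_zero,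
    Real.exp_zero, Complex.ofReal_one, mul_one, norm_mul, Complex.norm_real,
    Real.norm_of_nonneg (Real.exp_pos _).le, inv_div] at key
  rw [neg_mul, Real.exp_neg, ← div_eq_mul_inv, le_div_iff₀ (Real.exp_pos _), mul_comm]
  exact key
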